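/- There is an absolute constant C > 0 such that for all integers m ≥ t ≥ 1, setting N = C(m, t), if n ≥ C·N·log N and (X, Σ) is a random t-sparse set system with |X| = n and |Σ| = m, then E[disc(Σ)] ≤ C. -/

import Mathlib

open Finset

open scoped Classical

/-- The discrepancy of a set system `S : Fin m → Finset (Fin n)`. -/
noncomputable def disc {n m : ℕ} (S : Fin m → Finset (Fin n)) : ℕ :=
  sInf {d : ℕ | ∃ χ : Fin n → ℤ, (∀ x, χ x = 1 ∨ χ x = -1) ∧
    ∀ i : Fin m, (∑ x ∈ S i, χ x).natAbs ≤ d}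

/-- The hereditary discrepancy: the maximum of `disc` over restrictions to `Y ⊆ X`. -/
noncomputable def herdisc {n m : ℕ} (S : Fin m → Finset (Fin n)) : ℕ :=
  Finset.univ.sup fun Y : Finset (Fin n) => disc fun i => S i ∩ Y

/-- The sample space of a random `t`-sparse set system: each element `x ∈ X`
independently gets a uniformly random `t`-element subset `T x ⊆ [m]` of set indices.
The uniform distribution on this finite set is the distribution of the random system. -/
noncomputable def sparseChoices (n m t : ℕ) : Finset (Fin n → Finset (Fin m)) :=
  Finset.univ.filter fun T => ∀ x, (T x).card = t

/-- The set system determined by membership choices `T`: `S_i = {x : i ∈ T x}`. -/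
noncomputable def setsOf {n m : ℕ} (T : Fin n → Finset (Fin m)) : Fin m → Finset (Fin n) :=
  fun i => Finset.univ.filter fun x => i ∈ T x

/-- The indicator vectors of `S` and `S'` differ by `e_a - e_b` for some `a`, `b`. -/
def SwapRel (S S' : Finset ℕ) : Prop :=
  ∃ a b : ℕ, ∀ v : ℕ, (if v ∈ S then (1 : ℤ) else 0) - (if v ∈ S' then 1 else 0) =
    (if v = a then 1 else 0) - (if v = b then 1 else 0)

lemma SwapRel.refl (S : Finset ℕ) : SwapRel S S := ⟨0, 0, fun v => by simp⟩

lemma SwapRel.symm {S S' : Finset ℕ} (h : SwapRel S S') : SwapRel S' S := by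
  obtain ⟨a, b, h⟩ := h
  exact ⟨b, a, fun v => by linarith [h v]⟩

lemma SwapRel.insert {S S' : Finset ℕ} {x : ℕ} (h : SwapRel S S') (hS : x ∉ S) (hS' : x ∉ S') :
    SwapRel (insert x S) (insert x S') := by
  obtain ⟨a, b, h⟩ := h
  refine ⟨a, b, fun v => ?_⟩
  rw [← h v]
  by_cases hv : v = x
  · subst hv; simp [hS, hS']
  · simp [hv]

/-- The revolving door Gray code: the `k`-subsets of `{0, …, m - 1}`, listed so that consecutive
subsets differ by the exchange of one element. -/
def revolvingDoor : ℕ → ℕ → List (Finset ℕ)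
  | _, 0 => [∅]
  | 0, _ + 1 => []
  | m + 1, k + 1 => revolvingDoor m (k + 1) ++ (revolvingDoor m k).reverse.map (insert m)

lemma mem_revolvingDoor (m k : ℕ) (S : Finset ℕ) :
    S ∈ revolvingDoor m k ↔ S ⊆ range m ∧ S.card = k := by
  induction m generalizing k S with
  | zero => cases k with
    | zero => simp [revolvingDoor]
    | succ k =>
      simp only [revolvingDoor, List.not_mem_nil, range_zero, subset_empty, false_iff]
      rintro ⟨rfl, h⟩
      simp at h
  | succ m ih => cases k with
    | zero =>
      simp only [revolvingDoor, List.mem_singleton, Finset.card_eq_zero]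
      constructor
      · rintro rfl; simp
      · exact fun h => h.2
    | succ k =>
      simp only [revolvingDoor, List.mem_append, List.mem_map, List.mem_reverse, ih]
      constructor
      · rintro (⟨h1, h2⟩ | ⟨S, ⟨h1, h2⟩, rfl⟩)
        · exact ⟨h1.trans (range_subset_range.2 (Nat.le_succ m)), h2⟩
        · refine ⟨?_, ?_⟩
          · rw [range_add_one]; exact insert_subset_insert _ h1
          · rw [card_insert_of_notMem (fun h => by simpa using h1 h), h2]
      · rintro ⟨h1, h2⟩
        rw [range_add_one] at h1
        by_cases hm : m ∈ S
        · right
          exact ⟨S.erase m, ⟨subset_insert_iff.1 h1, by rw [card_erase_of_mem hm, h2]; rfl⟩,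
            insert_erase hm⟩
        · left
          exact ⟨(subset_insert_iff_of_notMem hm).1 h1, h2⟩

lemma notMem_of_mem_revolvingDoor {m k : ℕ} {S : Finset ℕ} (h : S ∈ revolvingDoor m k) :
    m ∉ S := fun hm => by simpa using ((mem_revolvingDoor m k S).1 h).1 hm

lemma nodup_revolvingDoor (m k : ℕ) : (revolvingDoor m k).Nodup := by
  induction m generalizing k with
  | zero => cases k <;> simp [revolvingDoor]
  | succ m ih => cases k with
    | zero => simp [revolvingDoor]
    | succ k =>
      rw [revolvingDoor, List.nodup_append']
      refine ⟨ih _, ?_, ?_⟩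
      · refine List.Nodup.map_on ?_ (List.nodup_reverse.2 (ih _))
        intro S hS S' hS' h
        rw [List.mem_reverse] at hS hS'
        rw [← erase_insert (notMem_of_mem_revolvingDoor hS), h,
          erase_insert (notMem_of_mem_revolvingDoor hS')]
      · intro S hS hS'
        obtain ⟨S', -, rfl⟩ := List.mem_map.1 hS'
        exact notMem_of_mem_revolvingDoor hS (mem_insert_self _ _)

lemma revolvingDoor_eq_nil {m k : ℕ} (h : m < k) : revolvingDoor m k = [] := by
  rw [List.eq_nil_iff_forall_not_mem]
  intro S hS
  obtain ⟨h1, h2⟩ := (mem_revolvingDoor m k S).1 hS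
  have := card_le_card h1
  rw [card_range] at this
  omega

lemma revolvingDoor_ends (m : ℕ) :
    (∀ k ≤ m, (revolvingDoor m k).head? = some (range k)) ∧
    (∀ k < m, (revolvingDoor m (k + 1)).getLast? = some (insert (m - 1) (range k))) := by
  induction m with
  | zero =>
    refine ⟨fun k hk => ?_, fun k hk => by omega⟩
    obtain rfl : k = 0 := by omega
    simp [revolvingDoor]
  | succ m ih =>
    refine ⟨fun k hk => ?_, fun k hk => ?_⟩
    · cases k with
      | zero => simp [revolvingDoor]
      | succ k =>
        rw [revolvingDoor]
        rcases Nat.lt_or_ge k m with h | h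
        · simp [List.head?_append, ih.1 (k + 1) h]
        · obtain rfl : k = m := by omega
          rw [revolvingDoor_eq_nil (Nat.lt_succ_self k), List.nil_append, List.head?_map,
            List.head?_reverse, range_add_one]
          cases k with
          | zero => simp [revolvingDoor]
          | succ k => rw [ih.2 k (Nat.lt_succ_self k)]; simp [range_add_one]
    · rw [revolvingDoor, List.getLast?_append, List.getLast?_map, List.getLast?_reverse,
        ih.1 k (by omega)]
      simp

lemma isChain_revolvingDoor (m k : ℕ) : (revolvingDoor m k).IsChain SwapRel := by
  induction m generalizing k with
  | zero => cases k <;> simp [revolvingDoor]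
  | succ m ih => cases k with
    | zero => simp [revolvingDoor]
    | succ k =>
      rw [revolvingDoor, List.isChain_append]
      refine ⟨ih _, ?_, ?_⟩
      · rw [List.isChain_map]
        have h : (revolvingDoor m k).reverse.IsChain SwapRel := by
          rw [List.isChain_reverse]
          exact (ih k).imp fun _ _ => SwapRel.symm
        rw [List.isChain_iff_getElem] at h ⊢
        intro i hi
        exact (h i hi).insert
          (notMem_of_mem_revolvingDoor (List.mem_reverse.1 (List.getElem_mem _)))
          (notMem_of_mem_revolvingDoor (List.mem_reverse.1 (List.getElem_mem _)))
      · rcases Nat.lt_or_ge k m with h | h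
        · obtain ⟨m, rfl⟩ : ∃ m', m = m' + 1 := ⟨m - 1, by omega⟩
          rw [(revolvingDoor_ends (m + 1)).2 k h, List.head?_map, List.head?_reverse]
          intro S hS S' hS'
          obtain rfl : insert m (range k) = S := by simpa using hS
          cases k with
          | zero =>
            simp only [revolvingDoor, List.getLast?_singleton, Option.map_some,
              Option.mem_some_iff] at hS'
            subst hS'
            exact ⟨m, m + 1, fun v => by simp⟩
          | succ k =>
            rw [(revolvingDoor_ends (m + 1)).2 k (by omega)] at hS'
            simp only [Option.map_some, Option.mem_some_iff] at hS'
            subst hS'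
            refine ⟨k, m + 1, fun v => ?_⟩
            simp only [mem_insert, mem_range]
            split_ifs <;> omega
        · rw [revolvingDoor_eq_nil (by omega)]
          simp

/-- A vector of the form `e_a - e_b`. -/
def IsEdge (u : ℕ → ℤ) : Prop :=
  ∃ a b : ℕ, ∀ v : ℕ, u v = (if v = a then 1 else 0) - (if v = b then 1 else 0)

lemma IsEdge.abs_le {u : ℕ → ℤ} (h : IsEdge u) (v : ℕ) : |u v| ≤ 1 := by
  obtain ⟨a, b, h⟩ := h
  rw [h v, _root_.abs_le]
  split_ifs <;> simp

/-- Two edges with a common endpoint can be concatenated into one edge. -/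
lemma IsEdge.merge {u w : ℕ → ℤ} (hu : IsEdge u) (hw : IsEdge w) {v : ℕ} (huv : u v ≠ 0)
    (hwv : w v ≠ 0) : ∃ η : ℤ, (η = 1 ∨ η = -1) ∧ IsEdge (u + η • w) := by
  obtain ⟨a, b, hu⟩ := hu
  obtain ⟨c, d, hw⟩ := hw
  rw [hu v] at huv
  rw [hw v] at hwv
  have h1 : v = a ∨ v = b := by
    by_contra! h
    simp [h.1, h.2] at huv
  have h2 : v = c ∨ v = d := by
    by_contra! h
    simp [h.1, h.2] at hwv
  rcases h1 with rfl | rfl <;> rcases h2 with h2 | h2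
  · exact ⟨-1, Or.inr rfl, d, b, fun x => by
      simp only [Pi.add_apply, Pi.smul_apply, smul_eq_mul, hu, hw, ← h2]; ring⟩
  · exact ⟨1, Or.inl rfl, c, b, fun x => by
      simp only [Pi.add_apply, Pi.smul_apply, smul_eq_mul, hu, hw, ← h2]; ring⟩
  · exact ⟨1, Or.inl rfl, a, d, fun x => by
      simp only [Pi.add_apply, Pi.smul_apply, smul_eq_mul, hu, hw, ← h2]; ring⟩
  · exact ⟨-1, Or.inr rfl, a, c, fun x => by
      simp only [Pi.add_apply, Pi.smul_apply, smul_eq_mul, hu, hw, ← h2]; ring⟩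

/-- Every multigraph has an orientation in which in- and out-degrees differ by at most one. -/
lemma exists_balanced_orientation {ι : Type*} [DecidableEq ι] (s : Finset ι) (u : ι → ℕ → ℤ)
    (hu : ∀ i ∈ s, IsEdge (u i)) :
    ∃ ε : ι → ℤ, (∀ i, ε i = 1 ∨ ε i = -1) ∧ ∀ v, |∑ i ∈ s, ε i * u i v| ≤ 1 := by
  induction hk : s.card generalizing s u with
  | zero =>
    obtain rfl := Finset.card_eq_zero.1 hk
    exact ⟨fun _ => 1, by simp, by simp⟩
  | succ k ih =>
    by_cases h : ∃ p ∈ s, ∃ q ∈ s, p ≠ q ∧ ∃ v, u p v ≠ 0 ∧ u q v ≠ 0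
    · obtain ⟨p, hp, q, hq, hpq, v, hpv, hqv⟩ := h
      obtain ⟨η, hη, hedge⟩ := (hu p hp).merge (hu q hq) hpv hqv
      have hp' : p ∈ s.erase q := mem_erase.2 ⟨hpq, hp⟩
      obtain ⟨ε, hε, hsum⟩ := ih (s.erase q) (Function.update u p (u p + η • u q))
        (fun i hi => by
          by_cases hip : i = p
          · subst hip; simpa using hedge
          · rw [Function.update_of_ne hip]; exact hu i (mem_of_mem_erase hi))
        (by rw [card_erase_of_mem hq, hk]; rfl)
      refine ⟨Function.update ε q (η * ε p), fun i => ?_, fun v => ?_⟩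
      · by_cases hi : i = q
        · subst hi
          rw [Function.update_self]
          rcases hη with h | h <;> rcases hε p with h' | h' <;> simp [h, h']
        · rw [Function.update_of_ne hi]; exact hε i
      · convert hsum v using 2
        rw [← add_sum_erase _ _ hq, ← add_sum_erase _ _ hp', ← add_sum_erase _ _ hp']
        have hrest : ∑ i ∈ (s.erase q).erase p, Function.update ε q (η * ε p) i * u i v =
            ∑ i ∈ (s.erase q).erase p, ε i * Function.update u p (u p + η • u q) i v := by
          refine sum_congr rfl fun i hi => ?_
          rw [mem_erase, mem_erase] at hi
          rw [Function.update_of_ne hi.2.1, Function.update_of_ne hi.1]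
        rw [hrest, Function.update_self, Function.update_of_ne hpq, Function.update_self]
        simp only [Pi.add_apply, Pi.smul_apply, smul_eq_mul]
        ring
    · push Not at h
      refine ⟨fun _ => 1, by simp, fun v => ?_⟩
      by_cases hv : ∃ p ∈ s, u p v ≠ 0
      · obtain ⟨p, hp, hpv⟩ := hv
        rw [sum_eq_single_of_mem p hp fun q hq hqp => by
          rw [h p hp q hq hqp.symm v hpv, mul_zero], one_mul]
        exact (hu p hp).abs_le v
      · push Not at hv
        rw [sum_eq_zero fun i hi => by rw [hv i hi, mul_zero]]
        simp

/-- A sequence of vectors with entries in `[-1, 1]` whose consecutive members differ by an edge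
can be signed so that the signed sum has entries in `[-2, 2]`. -/
lemma exists_signing_of_isEdge_sub (n : ℕ) (w : ℕ → ℕ → ℤ) (hw : ∀ j v, |w j v| ≤ 1)
    (h : ∀ j, j + 1 < n → IsEdge (w j - w (j + 1))) :
    ∃ c : ℕ → ℤ, (∀ j, c j = 1 ∨ c j = -1) ∧ ∀ v, |∑ j ∈ range n, c j * w j v| ≤ 2 := by
  obtain ⟨ε, hε, hsum⟩ := exists_balanced_orientation (range (n / 2))
    (fun i => w (2 * i) - w (2 * i + 1)) (fun i hi => h _ (by rw [mem_range] at hi; omega))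
  have hc : ∀ j, ε (j / 2) * (-1) ^ j = 1 ∨ ε (j / 2) * (-1) ^ j = -1 := fun j => by
    rcases hε (j / 2) with h | h <;> rcases neg_one_pow_eq_or ℤ j with h' | h' <;> simp [h, h']
  refine ⟨fun j => ε (j / 2) * (-1) ^ j, hc, fun v => ?_⟩
  have heven : ∀ k, ∑ j ∈ range (2 * k), ε (j / 2) * (-1) ^ j * w j v =
      ∑ i ∈ range k, ε i * (w (2 * i) - w (2 * i + 1)) v := by
    intro k
    induction k with
    | zero => simp
    | succ k ih =>
      rw [Nat.mul_succ, sum_range_succ, sum_range_succ, ih, sum_range_succ]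
      have h1 : 2 * k / 2 = k := by omega
      have h2 : (2 * k + 1) / 2 = k := by omega
      rw [h1, h2, pow_succ, pow_mul]
      simp only [Pi.sub_apply]
      ring
  have hmain := hsum v
  rw [← heven] at hmain
  rcases Nat.even_or_odd' n with ⟨k, hk | hk⟩
  · have : n / 2 = k := by omega
    rw [this] at hmain
    rw [hk]
    linarith
  · have : n / 2 = k := by omega
    rw [this] at hmain
    rw [hk, sum_range_succ]
    refine (abs_add_le _ _).trans ?_
    have hlast : |ε (2 * k / 2) * (-1) ^ (2 * k) * w (2 * k) v| ≤ 1 := by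
      rw [abs_mul]
      rcases hc (2 * k) with h | h <;> rw [h] <;> simpa using hw (2 * k) v
    linarith

lemma disc_le_of_coloring {n m : ℕ} {S : Fin m → Finset (Fin n)} {d : ℕ} (χ : Fin n → ℤ)
    (hχ : ∀ x, χ x = 1 ∨ χ x = -1) (h : ∀ i, |∑ x ∈ S i, χ x| ≤ d) : disc S ≤ d :=
  Nat.sInf_le ⟨χ, hχ, fun i => by
    have := h i
    rw [Int.abs_eq_natAbs] at this
    exact_mod_cast this⟩

lemma disc_le_card {n m : ℕ} (S : Fin m → Finset (Fin n)) : disc S ≤ n := by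
  refine disc_le_of_coloring (fun _ => 1) (by simp) fun i => ?_
  simpa using card_le_univ (S i)

/-- If every `t`-subset is chosen by some element, then the discrepancy is at most two. -/
lemma disc_setsOf_le_two {n m t : ℕ} (T : Fin n → Finset (Fin m)) (hT : ∀ x, (T x).card = t)
    (hall : ∀ S : Finset (Fin m), S.card = t → ∃ x, T x = S) : disc (setsOf T) ≤ 2 := by
  set l := revolvingDoor m t with hl
  set A : Fin n → Finset ℕ := fun x => (T x).map Fin.valEmbedding with hA
  have hAl : ∀ x, A x ∈ l := fun x => by
    rw [hl, mem_revolvingDoor]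
    refine ⟨fun v hv => ?_, by rw [hA, card_map, hT]⟩
    obtain ⟨i, -, rfl⟩ := mem_map.1 hv
    exact mem_range.2 i.2
  have hsurj : ∀ S ∈ l, ∃ x, A x = S := fun S hS => by
    obtain ⟨h1, h2⟩ := (mem_revolvingDoor m t S).1 hS
    have hmap : (S.attachFin fun i hi => mem_range.1 (h1 hi)).map Fin.valEmbedding = S :=
      map_valEmbedding_attachFin _
    obtain ⟨x, hx⟩ := hall (S.attachFin fun i hi => mem_range.1 (h1 hi)) (by simpa using h2)
    exact ⟨x, by rw [hA]; simp only; rw [hx, hmap]⟩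
  set r : Fin n → ℕ := fun x => l.idxOf (A x) with hr
  set σ := Tuple.sort r with hσ
  have hmono : Monotone (r ∘ σ) := Tuple.monotone_sort r
  have hrlt : ∀ x, r x < l.length := fun x => List.idxOf_lt_length_iff.2 (hAl x)
  have hget : ∀ x, l[r x]'(hrlt x) = A x := fun x => List.getElem_idxOf (hrlt x)
  have hstep : ∀ (j : ℕ) (hj : j + 1 < n),
      SwapRel (A (σ ⟨j, by omega⟩)) (A (σ ⟨j + 1, hj⟩)) := by
    intro j hj
    have hle : r (σ ⟨j, by omega⟩) ≤ r (σ ⟨j + 1, hj⟩) := hmono (by simp)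
    have hlt : r (σ ⟨j + 1, hj⟩) ≤ r (σ ⟨j, by omega⟩) + 1 := by
      by_contra! hcon
      have hb : r (σ ⟨j, by omega⟩) + 1 < l.length := hcon.trans (hrlt _)
      obtain ⟨x, hx⟩ := hsurj _ (List.getElem_mem hb)
      have hrx : r x = r (σ ⟨j, by omega⟩) + 1 := by
        rw [hr]
        simp only
        rw [hx]
        exact (nodup_revolvingDoor m t).idxOf_getElem _ _
      obtain ⟨i, rfl⟩ := σ.surjective x
      rcases Nat.lt_or_ge j i.1 with h | h
      · have : r (σ ⟨j + 1, hj⟩) ≤ r (σ i) := hmono (Fin.le_def.2 h)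
        omega
      · have : r (σ i) ≤ r (σ ⟨j, by omega⟩) := hmono (Fin.le_def.2 h)
        omega
    rw [← hget, ← hget]
    rcases hle.eq_or_lt with h | h
    · simp only [h]; exact SwapRel.refl _
    · have h' : r (σ ⟨j + 1, hj⟩) = r (σ ⟨j, by omega⟩) + 1 := by omega
      simp only [h']
      exact List.isChain_iff_getElem.1 (isChain_revolvingDoor m t) _ _
  let w : ℕ → ℕ → ℤ := fun j v =>
    if hj : j < n then (if v ∈ A (σ ⟨j, hj⟩) then 1 else 0) else 0
  obtain ⟨c, hc, hsum⟩ := exists_signing_of_isEdge_sub n w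
    (fun j v => by simp only [w]; split_ifs <;> simp)
    (fun j hj => by
      obtain ⟨a, b, hab⟩ := hstep j hj
      refine ⟨a, b, fun v => ?_⟩
      rw [← hab v]
      simp [w, hj, (Nat.lt_succ_self j).trans hj])
  refine disc_le_of_coloring (fun x => c (σ.symm x)) (fun x => hc _) fun i => ?_
  refine le_of_eq_of_le (congrArg _ ?_) (hsum i)
  rw [setsOf, sum_filter, ← Fin.sum_univ_eq_sum_range (fun j => c j * w j i), ← Equiv.sum_comp σ]
  refine sum_congr rfl fun j _ => ?_
  have hmem : (i : ℕ) ∈ A (σ j) ↔ i ∈ T (σ j) := by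
    simp [hA, Fin.val_inj]
  simp [w, hmem]

lemma sparseChoices_eq_piFinset (n m t : ℕ) :
    sparseChoices n m t = Fintype.piFinset fun _ => powersetCard t (univ : Finset (Fin m)) := by
  ext T
  simp [sparseChoices, mem_powersetCard]

lemma card_sparseChoices (n m t : ℕ) : (sparseChoices n m t).card = m.choose t ^ n := by
  simp [sparseChoices_eq_piFinset]

lemma card_sparseChoices_missing_le (n m t : ℕ) :
    ((sparseChoices n m t).filter fun T =>
      ¬ ∀ S : Finset (Fin m), S.card = t → ∃ x, T x = S).card ≤
      m.choose t * (m.choose t - 1) ^ n := by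
  calc _ ≤ ((powersetCard t (univ : Finset (Fin m))).biUnion fun S =>
        Fintype.piFinset fun _ : Fin n => (powersetCard t (univ : Finset (Fin m))).erase S).card := by
        refine card_le_card fun T hT => ?_
        rw [mem_filter] at hT
        obtain ⟨hT, hS⟩ := hT
        push Not at hS
        obtain ⟨S, hS, hne⟩ := hS
        simp only [sparseChoices, mem_filter, mem_univ, true_and] at hT
        simp only [mem_biUnion, mem_powersetCard, subset_univ, true_and, Fintype.mem_piFinset,
          mem_erase]
        exact ⟨S, hS, fun x => ⟨hne x, hT x⟩⟩
    _ ≤ (powersetCard t (univ : Finset (Fin m))).card * (m.choose t - 1) ^ n := by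
        refine card_biUnion_le_card_mul _ _ _ fun S hS => ?_
        simp [card_erase_of_mem hS]
    _ = _ := by simp

/-- The coupon collector estimate. -/
lemma mul_mul_sub_one_pow_le {N n : ℕ} (hN : 1 ≤ N) (h : 4 * (N : ℝ) * Real.log N ≤ n) :
    (n : ℝ) * (N * ((N - 1 : ℕ) : ℝ) ^ n) ≤ (N : ℝ) ^ n := by
  have hN0 : (0 : ℝ) < N := by exact_mod_cast hN
  set y : ℝ := n / N with hy
  have hn : (n : ℝ) = y * N := by rw [hy, div_mul_cancel₀ _ hN0.ne']
  have hlog : Real.log N ≤ y / 4 := by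
    rw [hy, le_div_iff₀ (by norm_num), le_div_iff₀ hN0]; linarith
  have hy0 : 0 ≤ y := by positivity
  have hpow : ((N - 1 : ℕ) : ℝ) ^ n ≤ (N : ℝ) ^ n * Real.exp (-y) := by
    have h1 : ((N - 1 : ℕ) : ℝ) ≤ N * Real.exp (-(1 / N)) := by
      have := mul_le_mul_of_nonneg_left (Real.add_one_le_exp (-(1 / (N : ℝ)))) hN0.le
      rw [Nat.cast_sub hN]
      refine le_trans (le_of_eq ?_) this
      field_simp
      push_cast
      ring
    calc ((N - 1 : ℕ) : ℝ) ^ n ≤ (N * Real.exp (-(1 / N))) ^ n :=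
          pow_le_pow_left₀ (Nat.cast_nonneg _) h1 n
      _ = (N : ℝ) ^ n * Real.exp (-y) := by
          rw [mul_pow, ← Real.exp_nat_mul]
          congr 2
          rw [hy]; ring
  have hNexp : (N : ℝ) * N ≤ Real.exp (y / 2) := by
    have : (N : ℝ) ≤ Real.exp (y / 4) := by
      rw [← Real.exp_log hN0]; exact Real.exp_le_exp.2 (by simpa using hlog)
    calc (N : ℝ) * N ≤ Real.exp (y / 4) * Real.exp (y / 4) := by gcongr
      _ = Real.exp (y / 2) := by rw [← Real.exp_add]; ring_nf
  have hyexp : y ≤ Real.exp (y / 2) := by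
    have h2 := Real.quadratic_le_exp_of_nonneg (x := y / 2) (by positivity)
    nlinarith [sq_nonneg (y - 2)]
  have hprod : y * (N * N) * Real.exp (-y) ≤ 1 := by
    calc y * (N * N) * Real.exp (-y) ≤ Real.exp (y / 2) * Real.exp (y / 2) * Real.exp (-y) := by
          gcongr
      _ = 1 := by rw [← Real.exp_add, ← Real.exp_add]; ring_nf; exact Real.exp_zero
  calc (n : ℝ) * (N * ((N - 1 : ℕ) : ℝ) ^ n) ≤ n * (N * ((N : ℝ) ^ n * Real.exp (-y))) := by gcongr
    _ = (y * (N * N) * Real.exp (-y)) * (N : ℝ) ^ n := by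
        generalize (N : ℝ) ^ n = P
        rw [hn]; ring
    _ ≤ 1 * (N : ℝ) ^ n := by gcongr
    _ = _ := one_mul _

/-- For `m ≥ t ≥ 1`, `N = C(m,t)`, and `n ≥ C·N·log N`, a random `t`-sparse set
system with `|X| = n`, `|Σ| = m` has expected discrepancy at most `C`. -/
theorem random_disc_expectation_many_columns :
    ∃ C : ℝ, 0 < C ∧ ∀ m t n : ℕ, 1 ≤ t → t ≤ m →
      C * (m.choose t : ℝ) * Real.log (m.choose t) ≤ (n : ℝ) →
      (∑ T ∈ sparseChoices n m t, (disc (setsOf T) : ℝ)) / (sparseChoices n m t).card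
        ≤ C := by
  refine ⟨4, by norm_num, fun m t n _ htm h => ?_⟩
  have hN : 1 ≤ m.choose t := Nat.choose_pos htm
  have hN0 : (0 : ℝ) < m.choose t := by exact_mod_cast hN
  have hpos : (0 : ℝ) < (m.choose t : ℝ) ^ n := by positivity
  rw [card_sparseChoices, Nat.cast_pow, div_le_iff₀ hpos,
    ← sum_filter_add_sum_filter_not _ fun T : Fin n → Finset (Fin m) =>
      ∀ S : Finset (Fin m), S.card = t → ∃ x, T x = S]
  have hgood : ∑ T ∈ (sparseChoices n m t).filter
      (fun T => ∀ S : Finset (Fin m), S.card = t → ∃ x, T x = S), (disc (setsOf T) : ℝ) ≤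
      (m.choose t : ℝ) ^ n * 2 := by
    refine (sum_le_card_nsmul _ _ 2 fun T hT => ?_).trans ?_
    · rw [mem_filter, sparseChoices, mem_filter] at hT
      exact_mod_cast disc_setsOf_le_two T hT.1.2 hT.2
    · rw [nsmul_eq_mul, ← Nat.cast_pow, ← card_sparseChoices]
      gcongr
      exact filter_subset _ _
  have hbad : ∑ T ∈ (sparseChoices n m t).filter
      (fun T => ¬ ∀ S : Finset (Fin m), S.card = t → ∃ x, T x = S), (disc (setsOf T) : ℝ) ≤
      (m.choose t : ℝ) ^ n := by
    refine (sum_le_card_nsmul _ _ (n : ℝ) fun T _ => by exact_mod_cast disc_le_card _).trans ?_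
    refine le_trans ?_ (mul_mul_sub_one_pow_le hN h)
    rw [nsmul_eq_mul, mul_comm]
    gcongr
    exact_mod_cast card_sparseChoices_missing_le n m t
  linarith
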